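/- arXiv:1702.07034 — 3 statements merged into one kernel-verified Lean document; each statement's English description precedes it below -/
import Mathlib

section
/- Let n ≥ 1, let 0 ≤ ε < 1, and let B be a symmetric bilinear form on ℝⁿ satisfying (1 − ε)‖v‖² ≤ B(v, v) ≤ (1 + ε)‖v‖² for all v ∈ ℝⁿ. Then for all u, w ∈ ℝⁿ, the Gram determinants satisfy (1 − ε)² · ( ‖u‖²‖w‖² − ⟨u, w⟩² ) ≤ B(u, u)B(w, w) − B(u, w)² ≤ (1 + ε)² · ( ‖u‖²‖w‖² − ⟨u, w⟩² ). -/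
open scoped InnerProductSpace

/-- The mixed discriminant of two positive semidefinite
symmetric `2 × 2` matrices is nonnegative. -/
theorem two_mul_mul_le_of_sq_le_mul {a b c d x y : ℝ} (ha : 0 ≤ a) (hb : 0 ≤ b) (hc : 0 ≤ c)
    (hd : 0 ≤ d) (hx : x ^ 2 ≤ a * b) (hy : y ^ 2 ≤ c * d) :
    2 * (x * y) ≤ a * d + b * c := by
  have hxy : x ^ 2 * y ^ 2 ≤ (a * b) * (c * d) :=
    mul_le_mul hx hy (sq_nonneg y) (mul_nonneg ha hb)
  refine (abs_le_of_sq_le_sq' ?_ (add_nonneg (mul_nonneg ha hd) (mul_nonneg hb hc))).2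
  nlinarith [sq_nonneg (a * d - b * c)]

/-- Gram determinants of pairs of vectors are monotone on positive semidefinite forms. -/
theorem gram_determinant_mono {E : Type*} [AddCommGroup E] [Module ℝ E]
    (B C : LinearMap.BilinForm ℝ E) (hB : B.IsSymm) (hC : C.IsSymm)
    (hC0 : ∀ v, 0 ≤ C v v) (hCB : ∀ v, C v v ≤ B v v) (u w : E) :
    C u u * C w w - C u w ^ 2 ≤ B u u * B w w - B u w ^ 2 := by
  have hD0 : ∀ v, 0 ≤ (B - C) v v := fun v => by simpa using hCB v
  have hx := C.apply_sq_le_of_symm hC0 ⟨hC.eq⟩ u w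
  have hy := (B - C).apply_sq_le_of_symm hD0 ⟨(hB.sub hC).eq⟩ u w
  have h := two_mul_mul_le_of_sq_le_mul (hC0 u) (hC0 w) (hD0 u) (hD0 w) hx hy
  simp only [LinearMap.sub_apply] at h hy
  linarith

/-- If a symmetric bilinear form `B` on ℝⁿ satisfies
`(1 − ε)‖v‖² ≤ B(v,v) ≤ (1 + ε)‖v‖²`, then its Gram determinants compare with the
Euclidean ones: `(1 − ε)²(‖u‖²‖w‖² − ⟨u,w⟩²) ≤ B(u,u)B(w,w) − B(u,w)² ≤
(1 + ε)²(‖u‖²‖w‖² − ⟨u,w⟩²)`. -/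
theorem gram_determinant_comparison
    (n : ℕ) (hn : 1 ≤ n) (ε : ℝ) (hε0 : 0 ≤ ε) (hε1 : ε < 1)
    (B : EuclideanSpace ℝ (Fin n) →ₗ[ℝ] EuclideanSpace ℝ (Fin n) →ₗ[ℝ] ℝ)
    (hsymm : ∀ v w, B v w = B w v)
    (hlower : ∀ v, (1 - ε) * ‖v‖ ^ 2 ≤ B v v)
    (hupper : ∀ v, B v v ≤ (1 + ε) * ‖v‖ ^ 2)
    (u w : EuclideanSpace ℝ (Fin n)) :
    (1 - ε) ^ 2 * (‖u‖ ^ 2 * ‖w‖ ^ 2 - ⟪u, w⟫_ℝ ^ 2) ≤ B u u * B w w - B u w ^ 2 ∧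
      B u u * B w w - B u w ^ 2 ≤ (1 + ε) ^ 2 * (‖u‖ ^ 2 * ‖w‖ ^ 2 - ⟪u, w⟫_ℝ ^ 2) := by
  have hB : LinearMap.BilinForm.IsSymm B := ⟨hsymm⟩
  have hS (c : ℝ) : LinearMap.BilinForm.IsSymm (c • innerₗ (EuclideanSpace ℝ (Fin n))) :=
    ⟨fun v w => by simp [real_inner_comm]⟩
  have hl := gram_determinant_mono B ((1 - ε) • innerₗ _) hB (hS _)
    (fun v => by simpa using mul_nonneg (sub_nonneg.2 hε1.le) (sq_nonneg ‖v‖))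
    (fun v => by simpa using hlower v) u w
  have hr := gram_determinant_mono ((1 + ε) • innerₗ _) B (hS _) hB
    (fun v => (mul_nonneg (sub_nonneg.2 hε1.le) (sq_nonneg ‖v‖)).trans (hlower v))
    (fun v => by simpa using hupper v) u w
  simp only [LinearMap.smul_apply, innerₗ_apply_apply, smul_eq_mul,
    real_inner_self_eq_norm_sq] at hl hr
  constructor <;> linarith
end

section
/- Let n ≥ 1, let 0 ≤ ε ≤ 1/100, let r > 0, and let g be a continuous Riemannian metric on the open ball B_r(0) ⊆ ℝⁿ such that (1 − ε)‖v‖² ≤ g_x(v, v) ≤ (1 + ε)‖v‖² for every x ∈ B_r(0) and v ∈ ℝⁿ. Let γ : [0,1] → B_r(0) be a C¹ curve with γ(0) = γ(1), and let c(t, s) = t · γ(s) be the cone over γ with vertex the origin. Then the image of c is contained in B_r(0), and the g-area of c satisfies A_g(c) ≤ r · L_g(γ), where L_g(γ) is the g-length of γ. -/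
open scoped InnerProductSpace

/-- A field of bilinear forms with continuous entries is jointly continuous. -/
lemma continuous_bilin_apply {X : Type*} [TopologicalSpace X] {n : ℕ}
    {g : EuclideanSpace ℝ (Fin n) →
      EuclideanSpace ℝ (Fin n) →ₗ[ℝ] EuclideanSpace ℝ (Fin n) →ₗ[ℝ] ℝ}
    (hg : ∀ v w, Continuous fun x => g x v w) {p v w : X → EuclideanSpace ℝ (Fin n)}
    (hp : Continuous p) (hv : Continuous v) (hw : Continuous w) :
    Continuous fun s => g (p s) (v s) (w s) := by
  let b := EuclideanSpace.basisFun (Fin n) ℝ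
  have expand : ∀ s, g (p s) (v s) (w s) =
      ∑ i, ∑ j, v s i * (w s j * g (p s) (b i) (b j)) := by
    intro s
    conv_lhs => rw [← b.sum_repr (v s), ← b.sum_repr (w s)]
    simp only [b, map_sum, map_smul, LinearMap.sum_apply, LinearMap.smul_apply, smul_eq_mul,
      EuclideanSpace.basisFun_repr, Finset.mul_sum]
    rw [Finset.sum_comm]
    exact Finset.sum_congr rfl fun i _ => Finset.sum_congr rfl fun j _ => by ring
  simp_rw [expand]
  refine continuous_finsetSum _ fun i _ => continuous_finsetSum _ fun j _ => ?_
  have := (hg (b i) (b j)).comp hp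
  simp only [Function.comp_def] at this
  fun_prop

/-- An interval integral of a nonnegative function is bounded by that of an integrable majorant;
the smaller function need not be integrable. -/
lemma intervalIntegral_mono_of_nonneg {f h : ℝ → ℝ} {a b : ℝ} (hab : a ≤ b)
    (hf : ∀ x ∈ Set.Icc a b, 0 ≤ f x) (hh : IntervalIntegrable h MeasureTheory.volume a b)
    (hfh : ∀ x ∈ Set.Icc a b, f x ≤ h x) :
    ∫ x in a..b, f x ≤ ∫ x in a..b, h x := by
  rw [intervalIntegral.integral_of_le hab, intervalIntegral.integral_of_le hab]
  refine MeasureTheory.integral_mono_of_nonneg ?_ hh.1 ?_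
  · exact (MeasureTheory.ae_restrict_mem measurableSet_Ioc).mono
      fun x hx => hf x (Set.Ioc_subset_Icc_self hx)
  · exact (MeasureTheory.ae_restrict_mem measurableSet_Ioc).mono
      fun x hx => hfh x (Set.Ioc_subset_Icc_self hx)

/-- For a continuous Riemannian metric `g` on the ball `B_r(0) ⊆ ℝⁿ` that is
`ε`-close to the Euclidean metric with `ε ≤ 1/100`, and a C¹ loop `γ : [0,1] → B_r(0)`,
the cone `c(t,s) = t • γ(s)` over `γ` with vertex the origin stays in `B_r(0)` and its
`g`-area is at most `r · L_g(γ)`. -/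
theorem cone_g_area_le_radius_mul_g_length
    (n : ℕ) (hn : 1 ≤ n) (ε : ℝ) (hε0 : 0 ≤ ε) (hε1 : ε ≤ 1 / 100) (r : ℝ) (hr : 0 < r)
    (g : EuclideanSpace ℝ (Fin n) →
      EuclideanSpace ℝ (Fin n) →ₗ[ℝ] EuclideanSpace ℝ (Fin n) →ₗ[ℝ] ℝ)
    (hg_cont : ∀ v w, Continuous fun x => g x v w)
    (hg_symm : ∀ x v w, g x v w = g x w v)
    (hg_lower : ∀ x ∈ Metric.ball (0 : EuclideanSpace ℝ (Fin n)) r, ∀ v,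
      (1 - ε) * ‖v‖ ^ 2 ≤ g x v v)
    (hg_upper : ∀ x ∈ Metric.ball (0 : EuclideanSpace ℝ (Fin n)) r, ∀ v,
      g x v v ≤ (1 + ε) * ‖v‖ ^ 2)
    (γ : ℝ → EuclideanSpace ℝ (Fin n)) (hγ : ContDiff ℝ 1 γ)
    (hγball : ∀ s ∈ Set.Icc (0:ℝ) 1, γ s ∈ Metric.ball (0 : EuclideanSpace ℝ (Fin n)) r)
    (hloop : γ 0 = γ 1) :
    (∀ t ∈ Set.Icc (0:ℝ) 1, ∀ s ∈ Set.Icc (0:ℝ) 1,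
        t • γ s ∈ Metric.ball (0 : EuclideanSpace ℝ (Fin n)) r) ∧
      (∫ t in (0:ℝ)..1, ∫ s in (0:ℝ)..1,
          Real.sqrt
            (g (t • γ s) (deriv (fun u : ℝ => u • γ s) t) (deriv (fun u : ℝ => u • γ s) t) *
              g (t • γ s) (deriv (fun u : ℝ => t • γ u) s) (deriv (fun u : ℝ => t • γ u) s) -
            g (t • γ s) (deriv (fun u : ℝ => u • γ s) t) (deriv (fun u : ℝ => t • γ u) s) ^ 2)) ≤
        r * ∫ t in (0:ℝ)..1, Real.sqrt (g (γ t) (deriv γ t) (deriv γ t)) := by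
  have hcone : ∀ t ∈ Set.Icc (0:ℝ) 1, ∀ s ∈ Set.Icc (0:ℝ) 1,
      t • γ s ∈ Metric.ball (0 : EuclideanSpace ℝ (Fin n)) r := by
    intro t ht s hs
    have h := hγball s hs
    rw [mem_ball_zero_iff] at h ⊢
    rw [norm_smul, Real.norm_of_nonneg ht.1]
    exact (mul_le_of_le_one_left (norm_nonneg _) ht.2).trans_lt h
  refine ⟨hcone, ?_⟩
  have hγ' : Continuous (deriv γ) := hγ.continuous_deriv le_rfl
  have hspeed : Continuous fun s => Real.sqrt (g (γ s) (deriv γ s) (deriv γ s)) :=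
    (continuous_bilin_apply hg_cont hγ.continuous hγ' hγ').sqrt
  have hdt : ∀ t s, deriv (fun u : ℝ => u • γ s) t = γ s := fun t s => by
    simpa using ((hasDerivAt_id t).smul_const (γ s)).deriv
  have hds : ∀ t s : ℝ, deriv (fun u : ℝ => t • γ u) s = t • deriv γ s := fun t s =>
    ((hγ.differentiable one_ne_zero s).hasDerivAt.fun_const_smul t).deriv
  simp only [hdt, hds]
  have hpointwise : ∀ t ∈ Set.Icc (0:ℝ) 1, ∀ s ∈ Set.Icc (0:ℝ) 1,
      Real.sqrt (g (t • γ s) (γ s) (γ s) * g (t • γ s) (t • deriv γ s) (t • deriv γ s) -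
        g (t • γ s) (γ s) (t • deriv γ s) ^ 2) ≤
      t * (2 * r) * Real.sqrt (g (γ s) (deriv γ s) (deriv γ s)) := by
    intro t ht s hs
    have hnorm : ‖γ s‖ ≤ r := (mem_ball_zero_iff.mp (hγball s hs)).le
    have hradial : g (t • γ s) (γ s) (γ s) ≤ (1 + ε) * r ^ 2 :=
      (hg_upper _ (hcone t ht s hs) _).trans (by gcongr)
    have htangent := hg_upper _ (hcone t ht s hs) (t • deriv γ s)
    have htangent_nonneg : 0 ≤ g (t • γ s) (t • deriv γ s) (t • deriv γ s) :=
      (mul_nonneg (by linarith) (sq_nonneg _)).trans (hg_lower _ (hcone t ht s hs) _)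
    have hlower := hg_lower _ (hγball s hs) (deriv γ s)
    rw [norm_smul, Real.norm_of_nonneg ht.1] at htangent
    have hcoef : (1 + ε) ^ 2 ≤ 4 * (1 - ε) := by nlinarith
    have ht0 := ht.1
    have hle : g (t • γ s) (γ s) (γ s) * g (t • γ s) (t • deriv γ s) (t • deriv γ s) -
        g (t • γ s) (γ s) (t • deriv γ s) ^ 2 ≤
        (t * (2 * r)) ^ 2 * g (γ s) (deriv γ s) (deriv γ s) :=
      calc
        _ ≤ g (t • γ s) (γ s) (γ s) * g (t • γ s) (t • deriv γ s) (t • deriv γ s) :=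
          sub_le_self _ (sq_nonneg _)
        _ ≤ ((1 + ε) * r ^ 2) * ((1 + ε) * (t * ‖deriv γ s‖) ^ 2) :=
          mul_le_mul hradial htangent htangent_nonneg (by positivity)
        _ = (1 + ε) ^ 2 * (r ^ 2 * t ^ 2 * ‖deriv γ s‖ ^ 2) := by ring
        _ ≤ 4 * (1 - ε) * (r ^ 2 * t ^ 2 * ‖deriv γ s‖ ^ 2) := by gcongr
        _ = (t * (2 * r)) ^ 2 * ((1 - ε) * ‖deriv γ s‖ ^ 2) := by ring
        _ ≤ _ := by gcongr
    refine (Real.sqrt_le_sqrt hle).trans_eq ?_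
    rw [Real.sqrt_mul (sq_nonneg _), Real.sqrt_sq (by positivity)]
  set L := ∫ t in (0:ℝ)..1, Real.sqrt (g (γ t) (deriv γ t) (deriv γ t)) with hL
  calc
    _ ≤ ∫ t in (0:ℝ)..1, t * (2 * r * L) := by
      refine intervalIntegral_mono_of_nonneg zero_le_one
        (fun t _ => intervalIntegral.integral_nonneg zero_le_one fun s _ => Real.sqrt_nonneg _)
        (Continuous.intervalIntegrable (by fun_prop) _ _) fun t ht => ?_
      refine (intervalIntegral_mono_of_nonneg zero_le_one (fun s _ => Real.sqrt_nonneg _)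
        ((hspeed.const_mul _).intervalIntegrable _ _) (hpointwise t ht)).trans_eq ?_
      rw [intervalIntegral.integral_const_mul, hL]
      ring
    _ = r * L := by
      rw [intervalIntegral.integral_mul_const, integral_id]
      ring
end

section
/- Let n ≥ 1, let X be a metric space, let K ≥ 1 and r > 0, and let Φ : ℝⁿ → X be a continuous map that is injective on the closed ball B̄_r(0) and such that Φ(B_r(0)) is open in X. Assume: (i) for every continuous σ : [0,1] → ℝⁿ with image in B̄_r(0), the total variation of σ is at most K times the total variation of Φ ∘ σ; and (ii) X is an approximate length space, i.e., for all p, q ∈ X and every δ > 0 there is a continuous path in X from p to q of total variation at most dist(p, q) + δ. Then the open metric ball B_{r/K}(Φ(0)) in X is contained in Φ(B_r(0)). -/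
open scoped NNReal ENNReal

open Set Metric

/-- A right inverse, with values in a compact set, of a continuous map which is injective on that
compact set depends continuously on its argument. -/
theorem IsCompact.continuousOn_of_comp_of_injOn {E X T : Type*} [TopologicalSpace E]
    [TopologicalSpace X] [T2Space X] [TopologicalSpace T] {s : Set E} (hs : IsCompact s)
    {Φ : E → X} (hΦ : ContinuousOn Φ s) (hinj : InjOn Φ s) {t : Set T} {σ : T → E}
    (hσ : MapsTo σ t s) (hcomp : ContinuousOn (Φ ∘ σ) t) : ContinuousOn σ t := by
  have : CompactSpace s := isCompact_iff_compactSpace.mp hs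
  have hemb := (continuousOn_iff_continuous_domRestrict.mp hΦ).isClosedEmbedding
    (injOn_iff_injective.mp hinj)
  have h : Continuous (hσ.restrict σ t s) :=
    hemb.isInducing.continuous_iff.mpr (continuousOn_iff_continuous_domRestrict.mp hcomp)
  exact continuousOn_iff_continuous_domRestrict.mpr (continuous_subtype_val.comp h)

/-- A path on `[0, 1]` from inside an open set `U` to outside it has a first exit time. -/
theorem exists_first_exit_time {X : Type*} [TopologicalSpace X] {U : Set X} (hU : IsOpen U)
    {f : ℝ → X} (hf : ContinuousOn f (Icc 0 1)) (h0 : f 0 ∈ U) (h1 : f 1 ∉ U) :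
    ∃ t ∈ Icc (0 : ℝ) 1, f t ∉ U ∧ f t ∈ closure U ∧ ∀ s ∈ Ico 0 t, f s ∈ U := by
  have hcpt : IsCompact (Icc (0 : ℝ) 1 ∩ f ⁻¹' Uᶜ) :=
    isCompact_Icc.of_isClosed_subset
      (hf.preimage_isClosed_of_isClosed isClosed_Icc hU.isClosed_compl) inter_subset_left
  obtain ⟨t, ⟨ht, htU⟩, hleast⟩ := hcpt.exists_isLeast ⟨1, by simp, h1⟩
  have hbefore : ∀ s ∈ Ico 0 t, f s ∈ U := fun s hs ↦ by
    by_contra hsU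
    exact hs.2.not_ge (hleast ⟨⟨hs.1, hs.2.le.trans ht.2⟩, hsU⟩)
  have htpos : (0 : ℝ) ≠ t := by
    rintro rfl
    exact htU h0
  refine ⟨t, ht, htU, ?_, hbefore⟩
  refine ((hf t ht).mono (Ico_subset_Icc_self.trans (Icc_subset_Icc_right ht.2))).mem_closure
    ?_ hbefore
  rw [closure_Ico htpos]
  exact ⟨ht.1, le_rfl⟩

/-- If `Φ : ℝⁿ → X` is continuous, injective on the closed ball `B̄_r(0)`, has
open image `Φ(B_r(0))`, pulls back curves in `B̄_r(0)` with length distortion at most `K`,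
and `X` is an approximate length space, then `B_{r/K}(Φ(0)) ⊆ Φ(B_r(0))`. -/
theorem ball_subset_image_of_length_distortion
    (n : ℕ) (hn : 1 ≤ n) (X : Type*) [MetricSpace X]
    (K r : ℝ) (hK : 1 ≤ K) (hr : 0 < r)
    (Φ : EuclideanSpace ℝ (Fin n) → X) (hΦc : Continuous Φ)
    (hinj : Set.InjOn Φ (Metric.closedBall 0 r))
    (hopen : IsOpen (Φ '' Metric.ball 0 r))
    (hlen : ∀ σ : ℝ → EuclideanSpace ℝ (Fin n), ContinuousOn σ (Set.Icc 0 1) →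
      (∀ t ∈ Set.Icc (0:ℝ) 1, σ t ∈ Metric.closedBall (0 : EuclideanSpace ℝ (Fin n)) r) →
      eVariationOn σ (Set.Icc 0 1) ≤
        ENNReal.ofReal K * eVariationOn (Φ ∘ σ) (Set.Icc 0 1))
    (hlength : ∀ p q : X, ∀ δ : ℝ, 0 < δ → ∃ f : ℝ → X,
      ContinuousOn f (Set.Icc 0 1) ∧ f 0 = p ∧ f 1 = q ∧
      eVariationOn f (Set.Icc 0 1) ≤ ENNReal.ofReal (dist p q + δ)) :
    Metric.ball (Φ 0) (r / K) ⊆ Φ '' Metric.ball 0 r := by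
  intro q hq
  by_contra hqU
  have hK0 : 0 < K := one_pos.trans_le hK
  obtain ⟨L, hL, hLr⟩ := exists_between (mem_ball'.mp hq)
  obtain ⟨f, hfc, hf0, hf1, hfL⟩ := hlength (Φ 0) q (L - dist (Φ 0) q) (sub_pos.mpr hL)
  rw [add_sub_cancel] at hfL
  obtain ⟨t, ht, htU, htcl, hbefore⟩ := exists_first_exit_time hopen hfc
    (hf0 ▸ mem_image_of_mem Φ (mem_ball_self hr)) (hf1 ▸ hqU)
  have hcpt : IsCompact (closedBall (0 : EuclideanSpace ℝ (Fin n)) r) := isCompact_closedBall 0 r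
  have hcl : closure (Φ '' ball 0 r) ⊆ Φ '' closedBall 0 r :=
    closure_minimal (image_mono ball_subset_closedBall) (hcpt.image hΦc).isClosed
  have hmem : ∀ s ∈ Icc (0 : ℝ) 1, f (t * s) ∈ Φ '' closedBall 0 r := fun s hs ↦ by
    rcases (mul_le_of_le_one_right ht.1 hs.2).lt_or_eq with h | h
    · exact hcl (subset_closure (hbefore _ ⟨mul_nonneg ht.1 hs.1, h⟩))
    · exact hcl (by rwa [h])
  have hscale : MapsTo (fun s ↦ t * s) (Icc (0 : ℝ) 1) (Icc 0 1) := fun s hs ↦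
    ⟨mul_nonneg ht.1 hs.1, mul_le_one₀ ht.2 hs.1 hs.2⟩
  choose! σ hσ hΦσ using hmem
  have hcongr : EqOn (Φ ∘ σ) (f ∘ fun s ↦ t * s) (Icc 0 1) := hΦσ
  have hσc : ContinuousOn σ (Icc 0 1) := hcpt.continuousOn_of_comp_of_injOn hΦc.continuousOn
    hinj hσ ((hfc.comp (by fun_prop) hscale).congr hcongr)
  have hσ0 : σ 0 = 0 := hinj (hσ 0 (by simp)) (mem_closedBall_self hr.le) (by
    rw [hΦσ 0 (by simp), mul_zero, hf0])
  have hσ1 : r ≤ dist (σ 1) (σ 0) := by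
    by_contra! h
    exact htU ⟨σ 1, by rwa [hσ0] at h, by rw [hΦσ 1 (by simp), mul_one]⟩
  have hvar : eVariationOn (Φ ∘ σ) (Icc 0 1) ≤ ENNReal.ofReal L := by
    rw [eVariationOn.congr hcongr]
    exact (eVariationOn.comp_le_of_monotoneOn f _
      (fun _ _ _ _ h ↦ mul_le_mul_of_nonneg_left h ht.1) hscale).trans hfL
  have hle : ENNReal.ofReal r ≤ ENNReal.ofReal (K * L) := calc
    ENNReal.ofReal r ≤ edist (σ 1) (σ 0) := by
      rw [edist_dist]
      exact ENNReal.ofReal_le_ofReal hσ1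
    _ ≤ eVariationOn σ (Icc 0 1) := eVariationOn.edist_le σ (by simp) (by simp)
    _ ≤ ENNReal.ofReal K * eVariationOn (Φ ∘ σ) (Icc 0 1) := hlen σ hσc hσ
    _ ≤ ENNReal.ofReal K * ENNReal.ofReal L := by gcongr
    _ = ENNReal.ofReal (K * L) := (ENNReal.ofReal_mul hK0.le).symm
  have hKL : K * L < r := (lt_div_iff₀' hK0).mp hLr
  exact ((ENNReal.ofReal_lt_ofReal_iff hr).mpr hKL).not_ge hle
end
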